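/- Moment-matching solution of the variational GM-fit problem (Lemma 3, matrix form): fix n ≥ 1 and a finite index set A; for a ∈ A let h_a ≥ 0 with H := ∑_a h_a > 0, μ_a ∈ ℝⁿ, and Σ_a a symmetric positive definite n×n real matrix. Define the moment-matched parameters μ* := H⁻¹ ∑_a h_a μ_a and Σ* := H⁻¹ ∑_a h_a (Σ_a + (μ_a − μ*)(μ_a − μ*)ᵀ), and note Σ* is symmetric positive definite. Then for every μ ∈ ℝⁿ and every symmetric positive definite n×n matrix Σ, ∑_a h_a [ (μ_a − μ)ᵀ Σ⁻¹ (μ_a − μ) + tr(Σ⁻¹ Σ_a) + log det Σ ] ≥ ∑_a h_a [ (μ_a − μ*)ᵀ (Σ*)⁻¹ (μ_a − μ*) + tr((Σ*)⁻¹ Σ_a) + log det Σ* ], with equality if and only if μ = μ* and Σ = Σ*. (This function equals, up to terms independent of (μ, Σ), twice the weighted sum ∑_a h_a · KL(N(μ_a, Σ_a) ‖ N(μ, Σ)) of KL divergences between Gaussians.) -/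

import Mathlib

open Matrix

/-- `log det M ≤ tr M - n` for positive definite `M`, with equality only at `1`. -/
lemma aux_logdet {n : ℕ} {M : Matrix (Fin n) (Fin n) ℝ} (hM : M.PosDef) :
    Real.log M.det ≤ M.trace - n ∧ (Real.log M.det = M.trace - n → M = 1) := by
  have hpos := hM.eigenvalues_pos
  have hdet : Real.log M.det = ∑ i, Real.log (hM.1.eigenvalues i) := by
    rw [hM.1.det_eq_prod_eigenvalues]
    simp only [RCLike.ofReal_real_eq_id, id]
    exact Real.log_prod (fun i _ => (hpos i).ne')
  have htr : M.trace - n = ∑ i, (hM.1.eigenvalues i - 1) := by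
    rw [hM.1.trace_eq_sum_eigenvalues]
    simp
  have hle : ∀ i ∈ Finset.univ, Real.log (hM.1.eigenvalues i) ≤ hM.1.eigenvalues i - 1 :=
    fun i _ => Real.log_le_sub_one_of_pos (hpos i)
  rw [hdet, htr]
  refine ⟨Finset.sum_le_sum hle, fun he => ?_⟩
  have h1 : hM.1.eigenvalues = fun _ => 1 := by
    funext i
    by_contra hne
    have := (Finset.sum_eq_sum_iff_of_le hle).1 he i (Finset.mem_univ i)
    exact (Real.log_lt_sub_one_of_pos (hpos i) hne).ne this
  have h2 : diagonal (RCLike.ofReal ∘ hM.1.eigenvalues) = (1 : Matrix (Fin n) (Fin n) ℝ) := by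
    rw [h1, ← diagonal_one]
    congr 1
  rw [hM.1.spectral_theorem, h2, map_one]

open scoped MatrixOrder in
/-- Two-matrix version. -/
lemma aux_two {n : ℕ} {P S : Matrix (Fin n) (Fin n) ℝ} (hP : P.PosDef) (hS : S.PosDef) :
    Real.log P.det + Real.log S.det ≤ (P * S).trace - n ∧
    (Real.log P.det + Real.log S.det = (P * S).trace - n → P * S = 1) := by
  obtain ⟨B, hB⟩ := CStarAlgebra.nonneg_iff_eq_star_mul_self.mp hP.posSemidef.nonneg
  rw [star_eq_conjTranspose] at hB
  have hBu : IsUnit B := by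
    have h1 := hP.det_pos
    rw [hB, det_mul] at h1
    rw [isUnit_iff_isUnit_det, isUnit_iff_ne_zero]
    intro h0
    rw [h0, mul_zero] at h1
    exact lt_irrefl _ h1
  have hM : (B * S * Bᴴ).PosDef :=
    hS.mul_mul_conjTranspose_same (vecMul_injective_iff_isUnit.mpr hBu)
  have hd : Real.log (B * S * Bᴴ).det = Real.log P.det + Real.log S.det := by
    rw [← Real.log_mul hP.det_pos.ne' hS.det_pos.ne', hB]
    simp only [det_mul]
    congr 1
    ring
  have ht : (B * S * Bᴴ).trace = (P * S).trace := by
    rw [trace_mul_comm, hB, Matrix.mul_assoc]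
  have key := aux_logdet hM
  rw [hd, ht] at key
  refine ⟨key.1, fun he => ?_⟩
  have h1 := key.2 he
  have h2 : Bᴴ * (B * S) = 1 := mul_eq_one_comm.mp h1
  rw [hB, Matrix.mul_assoc, h2]

lemma aux_quad {n : ℕ} (P : Matrix (Fin n) (Fin n) ℝ) (d : Fin n → ℝ) :
    (P * vecMulVec d d).trace = d ⬝ᵥ (P *ᵥ d) := by
  rw [mul_vecMulVec, trace_vecMulVec, dotProduct_comm]

/-- Bias-variance decomposition of the objective. -/
lemma aux_obj {n : ℕ} {A : Type*} [Fintype A]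
    (h : A → ℝ) (H : ℝ) (hH : H = ∑ a, h a) (hHpos : 0 < H)
    (μv : A → (Fin n → ℝ)) (Sm : A → Matrix (Fin n) (Fin n) ℝ)
    (μstar : Fin n → ℝ) (hμstar : μstar = H⁻¹ • ∑ a, h a • μv a)
    (Sstar : Matrix (Fin n) (Fin n) ℝ)
    (hSstar : Sstar
      = H⁻¹ • ∑ a, h a • (Sm a + vecMulVec (μv a - μstar) (μv a - μstar)))
    (P : Matrix (Fin n) (Fin n) ℝ) (c : ℝ) (μ : Fin n → ℝ) :
    ∑ a, h a * ((μv a - μ) ⬝ᵥ (P *ᵥ (μv a - μ)) + (P * Sm a).trace + c)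
      = H * ((μstar - μ) ⬝ᵥ (P *ᵥ (μstar - μ)) + (P * Sstar).trace + c) := by
  have hz : ∑ a, h a • (μv a - μstar) = 0 := by
    simp only [smul_sub, Finset.sum_sub_distrib]
    rw [← Finset.sum_smul, ← hH, hμstar, smul_smul, mul_inv_cancel₀ hHpos.ne', one_smul, sub_self]
  have ht : H * (P * Sstar).trace
      = ∑ a, h a * ((P * Sm a).trace + (μv a - μstar) ⬝ᵥ (P *ᵥ (μv a - μstar))) := by
    rw [hSstar, Matrix.mul_smul, trace_smul, smul_eq_mul, mul_inv_cancel_left₀ hHpos.ne',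
      Finset.mul_sum, trace_sum]
    refine Finset.sum_congr rfl fun a _ => ?_
    rw [Matrix.mul_smul, trace_smul, smul_eq_mul, Matrix.mul_add, trace_add, aux_quad]
  have hc1 : ∑ a, h a * ((μv a - μstar) ⬝ᵥ (P *ᵥ (μstar - μ))) = 0 := by
    have : (∑ a, h a • (μv a - μstar)) ⬝ᵥ (P *ᵥ (μstar - μ)) = 0 := by
      rw [hz, zero_dotProduct]
    rw [sum_dotProduct] at this
    simpa only [smul_dotProduct, smul_eq_mul] using this
  have hc2 : ∑ a, h a * ((μstar - μ) ⬝ᵥ (P *ᵥ (μv a - μstar))) = 0 := by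
    have : (μstar - μ) ⬝ᵥ (P *ᵥ (∑ a, h a • (μv a - μstar))) = 0 := by
      rw [hz, mulVec_zero, dotProduct_zero]
    rw [mulVec_sum, dotProduct_sum] at this
    simpa only [mulVec_smul, dotProduct_smul, smul_eq_mul] using this
  have hexp : ∀ a, h a * ((μv a - μ) ⬝ᵥ (P *ᵥ (μv a - μ)) + (P * Sm a).trace + c)
      = h a * ((P * Sm a).trace + (μv a - μstar) ⬝ᵥ (P *ᵥ (μv a - μstar)))
        + h a * ((μv a - μstar) ⬝ᵥ (P *ᵥ (μstar - μ)))
        + h a * ((μstar - μ) ⬝ᵥ (P *ᵥ (μv a - μstar)))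
        + h a * ((μstar - μ) ⬝ᵥ (P *ᵥ (μstar - μ)) + c) := by
    intro a
    have e : μv a - μ = (μv a - μstar) + (μstar - μ) := by abel
    rw [e]
    generalize μv a - μstar = d
    simp only [mulVec_add, dotProduct_add, add_dotProduct]
    ring
  rw [Finset.sum_congr rfl fun a _ => hexp a]
  simp only [Finset.sum_add_distrib]
  rw [hc1, hc2, ← ht, ← Finset.sum_mul, ← hH]
  ring


/-- Moment-matching solution of the variational GM-fit problem (Lemma 3,
matrix form): the moment-matched parameters `(μ*, Σ*)` are positive definite
and uniquely minimize the weighted Gaussian KL objective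
`∑_a h_a [ (μ_a−μ)ᵀΣ⁻¹(μ_a−μ) + tr(Σ⁻¹Σ_a) + log det Σ ]`. -/
theorem stmt7 {n : ℕ} (hn : 1 ≤ n) {A : Type*} [Fintype A]
    (h : A → ℝ) (hh : ∀ a, 0 ≤ h a)
    (H : ℝ) (hH : H = ∑ a, h a) (hHpos : 0 < H)
    (μv : A → (Fin n → ℝ)) (Sm : A → Matrix (Fin n) (Fin n) ℝ)
    (hSm : ∀ a, (Sm a).PosDef)
    (μstar : Fin n → ℝ) (hμstar : μstar = H⁻¹ • ∑ a, h a • μv a)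
    (Sstar : Matrix (Fin n) (Fin n) ℝ)
    (hSstar : Sstar
      = H⁻¹ • ∑ a, h a • (Sm a + vecMulVec (μv a - μstar) (μv a - μstar))) :
    Sstar.PosDef ∧
    ∀ (μ : Fin n → ℝ) (Sg : Matrix (Fin n) (Fin n) ℝ), Sg.PosDef →
      (∑ a, h a * ((μv a - μstar) ⬝ᵥ (Sstar⁻¹ *ᵥ (μv a - μstar))
            + (Sstar⁻¹ * Sm a).trace + Real.log Sstar.det)
        ≤ ∑ a, h a * ((μv a - μ) ⬝ᵥ (Sg⁻¹ *ᵥ (μv a - μ))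
            + (Sg⁻¹ * Sm a).trace + Real.log Sg.det))
      ∧ (∑ a, h a * ((μv a - μ) ⬝ᵥ (Sg⁻¹ *ᵥ (μv a - μ))
            + (Sg⁻¹ * Sm a).trace + Real.log Sg.det)
          = ∑ a, h a * ((μv a - μstar) ⬝ᵥ (Sstar⁻¹ *ᵥ (μv a - μstar))
            + (Sstar⁻¹ * Sm a).trace + Real.log Sstar.det)
        ↔ μ = μstar ∧ Sg = Sstar) := by
  have hS : Sstar.PosDef := by
    have hv : ∀ a, (Sm a + vecMulVec (μv a - μstar) (μv a - μstar)).PosDef := fun a =>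
      (hSm a).add_posSemidef (by simpa using posSemidef_vecMulVec_self_star (μv a - μstar))
    obtain ⟨a₀, -, ha₀⟩ : ∃ a ∈ Finset.univ, 0 < h a := by
      by_contra! hcon
      have := Finset.sum_nonpos hcon
      linarith
    classical
    rw [hSstar]
    refine PosDef.smul ?_ (inv_pos.mpr hHpos)
    rw [← Finset.add_sum_erase _ _ (Finset.mem_univ a₀)]
    exact ((hv a₀).smul ha₀).add_posSemidef
      (posSemidef_sum _ fun a _ => (hv a).posSemidef.smul (hh a))
  refine ⟨hS, fun μ Sg hSg => ?_⟩
  have hobj := aux_obj h H hH hHpos μv Sm μstar hμstar Sstar hSstar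
  rw [hobj Sstar⁻¹ _ μstar, hobj Sg⁻¹ _ μ]
  have h1 : Sstar⁻¹ * Sstar = 1 := nonsing_inv_mul _ ((isUnit_iff_isUnit_det _).mp hS.isUnit)
  have h2 : Sg * Sg⁻¹ = 1 := mul_nonsing_inv _ ((isUnit_iff_isUnit_det _).mp hSg.isUnit)
  have hld : Real.log Sg⁻¹.det = - Real.log Sg.det := by
    rw [det_nonsing_inv, Ring.inverse_eq_inv', Real.log_inv]
  have key := aux_two hSg.inv hS
  rw [hld] at key
  have hq : 0 ≤ (μstar - μ) ⬝ᵥ (Sg⁻¹ *ᵥ (μstar - μ)) := by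
    simpa using hSg.inv.posSemidef.dotProduct_mulVec_nonneg (μstar - μ)
  have e0 : (μstar - μstar) ⬝ᵥ (Sstar⁻¹ *ᵥ (μstar - μstar)) + (Sstar⁻¹ * Sstar).trace
      + Real.log Sstar.det = n + Real.log Sstar.det := by
    rw [h1]
    simp
  refine ⟨?_, fun he => ?_, ?_⟩
  · rw [e0]
    refine mul_le_mul_of_nonneg_left ?_ hHpos.le
    linarith [key.1]
  · have he' := mul_left_cancel₀ hHpos.ne' he
    rw [e0] at he'
    have hinv : Sg⁻¹ * Sstar = 1 := key.2 (by linarith [key.1])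
    have hq0 : (μstar - μ) ⬝ᵥ (Sg⁻¹ *ᵥ (μstar - μ)) = 0 := by linarith [key.1]
    constructor
    · by_contra hne
      have := hSg.inv.dotProduct_mulVec_pos (x := μstar - μ)
        (fun h0 => hne (sub_eq_zero.mp h0).symm)
      simp only [star_trivial] at this
      linarith
    · calc Sg = Sg * (Sg⁻¹ * Sstar) := by rw [hinv, Matrix.mul_one]
        _ = Sstar := by rw [← Matrix.mul_assoc, h2, Matrix.one_mul]
  · rintro ⟨rfl, rfl⟩
    rfl
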